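/- Let c : darts → ℝ be a dart cost function admitting no negative-cost directed cycles, let c' be its lexicographic perturbation, and let s, t ∈ V. Then the shortest directed path from s to t with respect to c' (i.e., the directed s,t-path of lexicographically minimum total perturbed cost) is unique, and it is also a shortest s,t-path with respect to the unperturbed costs c. -/

import Mathlib

/-!
Common combinatorial framework for graphs cellularly embedded on orientable surfaces,
following Erickson, Fox, and Lkhamsuren, "Holiest Minimum-Cost Paths and Flows in
Surface Graphs".

A graph `G = (V, E, F)` embedded on an orientable surface is given combinatorially by a
finite set of darts together with a fixed-point-free involution `rev` (whose orbits are
the edges) and a permutation `next` (= π, whose orbits are the vertices); the faces are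
the orbits of `rev ∘ next`, and the genus `g` is determined by Euler's formula
`|V| - |E| + |F| = 2 - 2g`.
-/

noncomputable section

open Finset

open scoped Classical

set_option maxHeartbeats 1000000

structure CombSurface where
  /-- the darts -/
  D : Type
  /-- the vertices (orbits of `next`) -/
  V : Type
  /-- the faces (orbits of `rev ∘ next`) -/
  F : Type
  [finD : Fintype D]
  [deqD : DecidableEq D]
  [finV : Fintype V]
  [deqV : DecidableEq V]
  [finF : Fintype F]
  [deqF : DecidableEq F]
  /-- the reversal involution on darts; its orbits are the edges -/
  rev : D → D
  rev_invol : ∀ d, rev (rev d) = d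
  rev_ne : ∀ d, rev d ≠ d
  /-- the rotation permutation π: orbits are the darts directed into a common vertex,
  in counterclockwise order -/
  next : D → D
  next_bij : Function.Bijective next
  /-- the head of a dart: the orbit map of `next` -/
  head : D → V
  head_next : ∀ d, head (next d) = head d
  head_orbit : ∀ d₁ d₂, head d₁ = head d₂ → ∃ n : ℕ, next^[n] d₁ = d₂
  head_surj : Function.Surjective head
  /-- the face to the left of a dart: the orbit map of `rev ∘ next` -/
  left : D → F
  left_step : ∀ d, left (rev (next d)) = left d
  left_orbit : ∀ d₁ d₂, left d₁ = left d₂ → ∃ n : ℕ, (fun x => rev (next x))^[n] d₁ = d₂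
  left_surj : Function.Surjective left
  /-- the genus -/
  g : ℕ
  /-- Euler's formula `|V| - |E| + |F| = 2 - 2g` (with `2|E| = |D|`) -/
  euler : 2 * (Fintype.card V : ℤ) + 2 * (Fintype.card F : ℤ) - (Fintype.card D : ℤ)
      = 4 - 4 * (g : ℤ)

attribute [instance] CombSurface.finD CombSurface.deqD CombSurface.finV
  CombSurface.deqV CombSurface.finF CombSurface.deqF

namespace CombSurface

variable (S : CombSurface)

/-- The tail of a dart. -/
def tail (d : S.D) : S.V := S.head (S.rev d)

/-- The face to the right of a dart.  The dual dart of `d` crosses `d` from the face on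
its left to the face on its right; i.e. the dual dart of `d` has tail `S.left d` and
head `S.right d`. -/
def right (d : S.D) : S.F := S.left (S.rev d)

/-- The imbalance of a flow `f` at a vertex `v`: the net flow into `v`. -/
def imbalance (f : S.D → ℝ) (v : S.V) : ℝ :=
  ∑ d ∈ univ.filter (fun d => S.head d = v), f d -
    ∑ d ∈ univ.filter (fun d => S.tail d = v), f d

/-- `f` is the boundary flow of the potential function `α` on the faces. -/
def IsBoundary (f : S.D → ℝ) (α : S.F → ℝ) : Prop :=
  ∀ d, f d - f (S.rev d) = α (S.right d) - α (S.left d)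

/-- The dual imbalance of a dual flow `z` at a face `p`: the sum of `z` over all darts
whose dual darts have head `p`. -/
def dualImbalance (z : S.D → ℝ) (p : S.F) : ℝ :=
  ∑ d ∈ univ.filter (fun d => S.right d = p), z d

/-- A drainage with sink `r`: an antisymmetric dual flow whose dual imbalance is negative
at every face other than `r`. -/
def IsDrainage (z : S.D → ℝ) (r : S.F) : Prop :=
  (∀ d, z (S.rev d) = - z d) ∧ ∀ q, q ≠ r → S.dualImbalance z q < 0

/-- A set of darts closed under reversal (i.e. a set of edges). -/
def RevClosed (A : Finset S.D) : Prop := ∀ d ∈ A, S.rev d ∈ A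

/-- The edge set `A` connects all vertices of the primal graph. -/
def PrimalConnected (A : Finset S.D) : Prop :=
  ∀ v w : S.V, Relation.ReflTransGen (fun a b => ∃ d ∈ A, S.tail d = a ∧ S.head d = b) v w

/-- The edge set `A` connects all vertices of the dual graph (i.e. the faces). -/
def DualConnected (A : Finset S.D) : Prop :=
  ∀ p q : S.F, Relation.ReflTransGen (fun a b => ∃ d ∈ A, S.left d = a ∧ S.right d = b) p q

/-- A spanning tree of `G`: a connected spanning set of edges with `|V| - 1` edges. -/
def IsSpanningTree (A : Finset S.D) : Prop :=
  S.RevClosed A ∧ S.PrimalConnected A ∧ A.card = 2 * (Fintype.card S.V - 1)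

/-- A spanning cotree of `G`: a set of edges forming a spanning tree of the dual graph. -/
def IsSpanningCotree (A : Finset S.D) : Prop :=
  S.RevClosed A ∧ S.DualConnected A ∧ A.card = 2 * (Fintype.card S.F - 1)

/-- The clockwise neighborhood `∂⁻(F')` of a set of faces: all darts whose dual darts
have tail outside `F'` and head inside `F'`. -/
def cwBoundary (F' : Finset S.F) : Finset S.D :=
  univ.filter fun d => S.left d ∉ F' ∧ S.right d ∈ F'

end CombSurface

/-- A tree–cotree decomposition of `G`: a partition of the edges into a spanning tree `T`,
a spanning cotree `C`, and a set `L` of leftover edges. -/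
structure TreeCotree (S : CombSurface) where
  T : Finset S.D
  L : Finset S.D
  C : Finset S.D
  tree : S.IsSpanningTree T
  cotree : S.IsSpanningCotree C
  revL : S.RevClosed L
  disjTL : Disjoint T L
  disjTC : Disjoint T C
  disjLC : Disjoint L C
  cover : T ∪ L ∪ C = Finset.univ

/-- Homology signature data: a tree–cotree decomposition `(T, L, C)` together with an
ordering `ell 1, …, ell 2g` of (oriented) leftover edges of `L` and, for each `i`, the
oriented dual fundamental cycle `cyc i` of the edge of `ell i` with the cotree `C`,
represented as the `{-1,0,1}`-valued dual circulation supported on `C + ell i` that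
traverses the dart `ell i` (positively).  The homology signature of a dart `d` is the
integer vector `[d] = fun i => cyc i d`. -/
structure HomologyBasis (S : CombSurface) extends TreeCotree S where
  /-- the `i`-th leftover edge, oriented -/
  ell : Fin (2 * S.g) → S.D
  ell_mem : ∀ i, ell i ∈ L
  ell_inj : ∀ i j, (ell i = ell j ∨ ell i = S.rev (ell j)) → i = j
  ell_cover : ∀ d ∈ L, ∃ i, d = ell i ∨ d = S.rev (ell i)
  /-- the oriented dual fundamental cycle of `ell i` with the cotree `C`,
  as a dual circulation -/
  cyc : Fin (2 * S.g) → S.D → ℤ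
  cyc_antisym : ∀ i d, cyc i (S.rev d) = - cyc i d
  cyc_le_one : ∀ i d, |cyc i d| ≤ 1
  cyc_circ : ∀ i p, (∑ d ∈ univ.filter (fun d => S.right d = p), cyc i d) = 0
  cyc_supp : ∀ i d, cyc i d ≠ 0 → d ∈ C ∨ d = ell i ∨ d = S.rev (ell i)
  cyc_ell : ∀ i, cyc i (ell i) = 1

/-- The homology signature `[f]` of a flow `f`: `[f] = ∑ d, f d • [d]`. -/
def flowSig (S : CombSurface) (H : HomologyBasis S) (f : S.D → ℝ) : Fin (2 * S.g) → ℝ :=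
  fun i => ∑ d, f d * (H.cyc i d : ℝ)

/-- Strict lexicographic comparison of cost vectors. -/
def lexLt {n : ℕ} (a b : Fin n → ℝ) : Prop :=
  ∃ i, (∀ j, j < i → a j = b j) ∧ a i < b i

/-- Lexicographic comparison of cost vectors. -/
def lexLe {n : ℕ} (a b : Fin n → ℝ) : Prop := lexLt a b ∨ a = b

/-- The perturbed cost of a dart under the full lexicographic perturbation scheme:
`c'(d) = (c(d), 1) ++ [d] ++ (z(d))`. -/
def dartCostFull (S : CombSurface) (H : HomologyBasis S) (z : S.D → ℝ) (c : S.D → ℝ)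
    (d : S.D) : Fin (2 * S.g + 3) → ℝ :=
  Fin.cons (c d) (Fin.cons 1 (Fin.snoc (fun i => (H.cyc i d : ℝ)) (z d)))

/-- The perturbed cost of a dart under the modified lexicographic perturbation scheme
(no `+1` component): `c'(d) = (c(d)) ++ [d] ++ (z(d))`. -/
def dartCostMod (S : CombSurface) (H : HomologyBasis S) (z : S.D → ℝ) (c : S.D → ℝ)
    (d : S.D) : Fin (2 * S.g + 2) → ℝ :=
  Fin.cons (c d) (Fin.snoc (fun i => (H.cyc i d : ℝ)) (z d))

/-- The perturbed cost of a flow: `c'(f) = ∑ d, f d • c'(d)`. -/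
def flowCostFull (S : CombSurface) (H : HomologyBasis S) (z : S.D → ℝ) (c : S.D → ℝ)
    (f : S.D → ℝ) : Fin (2 * S.g + 3) → ℝ :=
  ∑ d, f d • dartCostFull S H z c d

/-- The unperturbed part of a cost vector from the modified scheme (first component). -/
def basePart {g : ℕ} (w : Fin (2 * g + 2) → ℝ) : ℝ := w ⟨0, by omega⟩

/-- The homology part of a cost vector from the modified scheme (middle `2g` components). -/
def homPart {g : ℕ} (w : Fin (2 * g + 2) → ℝ) : Fin (2 * g) → ℝ :=
  fun i => w ⟨(i : ℕ) + 1, by have := i.isLt; omega⟩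

/-- The face part of a cost vector from the modified scheme (last component). -/
def facePart {g : ℕ} (w : Fin (2 * g + 2) → ℝ) : ℝ := w ⟨2 * g + 1, by omega⟩

/-- Feasibility of a flow with respect to dart capacities `μ` and vertex demands `b`. -/
def Feasible (S : CombSurface) (μ : S.D → ENNReal) (b : S.V → ℝ) (f : S.D → ℝ) : Prop :=
  (∀ d, 0 ≤ f d ∧ ENNReal.ofReal (f d) ≤ μ d) ∧ ∀ v, S.imbalance f v = b v

/-- A minimum-cost feasible flow with respect to the perturbed costs `c'`, capacities `μ`,
and demands `b`, where costs are compared lexicographically. -/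
def IsMinCostFlow (S : CombSurface) (H : HomologyBasis S) (z : S.D → ℝ) (c : S.D → ℝ)
    (μ : S.D → ENNReal) (b : S.V → ℝ) (f : S.D → ℝ) : Prop :=
  Feasible S μ b f ∧ ∀ f', Feasible S μ b f' →
    lexLe (flowCostFull S H z c f) (flowCostFull S H z c f')

/-- `IsWalk S s t P`: the list of darts `P` is a directed walk from `s` to `t`. -/
def IsWalk (S : CombSurface) : S.V → S.V → List S.D → Prop
  | s, t, [] => s = t
  | s, t, d :: P => S.tail d = s ∧ IsWalk S (S.head d) t P

/-- `IsDualWalk S p q P`: the list of darts `P` is a directed walk from face `p` to face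
`q` in the dual graph. -/
def IsDualWalk (S : CombSurface) : S.F → S.F → List S.D → Prop
  | p, q, [] => p = q
  | p, q, d :: P => S.left d = p ∧ IsDualWalk S (S.right d) q P

/-- The cost vector of a walk: the sum of the cost vectors of its darts. -/
def pathCost {n : ℕ} (S : CombSurface) (cp : S.D → Fin n → ℝ) (P : List S.D) :
    Fin n → ℝ :=
  (P.map cp).sum

/-- `P` is a lexicographically shortest directed walk from `s` to `t` with respect to the
vector-valued dart costs `cp`. -/
def IsShortestWalk {n : ℕ} (S : CombSurface) (cp : S.D → Fin n → ℝ) (s t : S.V)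
    (P : List S.D) : Prop :=
  IsWalk S s t P ∧ ∀ Q, IsWalk S s t Q → lexLe (pathCost S cp P) (pathCost S cp Q)

/-- A list of darts viewed as a flow: each dart receives the number of times it occurs. -/
def listFlow (S : CombSurface) (P : List S.D) : S.D → ℝ := fun d => (P.count d : ℝ)

/-- The parent map of a spanning cotree rooted at `r`, given the successor darts. -/
def parentOfSucc (S : CombSurface) (r : S.F) (succ : S.F → S.D) (p : S.F) : S.F :=
  if p = r then r else S.right (succ p)

/-- The descendants of a face `p` in the cotree rooted at `r` (including `p` itself). -/
def descendants (S : CombSurface) (r : S.F) (succ : S.F → S.D) (p : S.F) :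
    Finset S.F :=
  univ.filter fun o => ∃ m : ℕ, (parentOfSucc S r succ)^[m] o = p

/-- The dual flow sending one unit of flow from every face to `r` along the cotree:
on a successor dart `succ p` its value is the number of descendants of `p`, on the
reversal of a successor dart it is the negation of that number, and on darts whose edges
are not in the cotree it is `0`. -/
def treeDrainage (S : CombSurface) (r : S.F) (succ : S.F → S.D) (d : S.D) : ℝ :=
  if ∃ p, p ≠ r ∧ succ p = d then ((descendants S r succ (S.left d)).card : ℝ)
  else if ∃ p, p ≠ r ∧ succ p = S.rev d then
    -((descendants S r succ (S.left (S.rev d))).card : ℝ)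
  else 0

/-- `RedOf S pred v u x`: in the tree rooted at `v` with predecessor darts `pred`, the
tree path from `v` to `x` passes through `u` (when `pred u` is the dart `v→u`, this says
exactly that the tree path from `v` to `x` uses the dart `v→u`, i.e. `x` is red). -/
def RedOf (S : CombSurface) (pred : S.V → S.D) (v u x : S.V) : Prop :=
  ∃ m : ℕ, (fun y => if y = v then v else S.tail (pred y))^[m] x = u

/-- The darts of the tree determined by the predecessor darts `pred` (both orientations
of each tree edge). -/
def predDarts (S : CombSurface) (pred : S.V → S.D) (v : S.V) : Set S.D :=
  {d | ∃ x, x ≠ v ∧ (pred x = d ∨ pred x = S.rev d)}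

/-- A shortest path tree rooted at `v` with respect to vector-valued dart costs `cost`,
together with the (lexicographic) shortest path distances: every non-root vertex has a
tense predecessor dart, all darts have non-negative slack, and the predecessor darts form
a tree reaching back to the root. -/
structure SPTree (S : CombSurface) {n : ℕ} (cost : S.D → Fin n → ℝ) (v : S.V) where
  pred : S.V → S.D
  dist : S.V → Fin n → ℝ
  dist_root : dist v = 0
  pred_head : ∀ x, x ≠ v → S.head (pred x) = x
  pred_tense : ∀ x, x ≠ v → dist x = dist (S.tail (pred x)) + cost (pred x)
  slack_nonneg : ∀ d, lexLe (dist (S.head d)) (dist (S.tail d) + cost d)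
  reach : ∀ x, ∃ m : ℕ, (fun y => if y = v then v else S.tail (pred y))^[m] x = v

namespace SPTree

variable {S : CombSurface} {n : ℕ} {cost : S.D → Fin n → ℝ} {v : S.V}

/-- The slack of a dart: `slack(x→y) = dist(x) + cost(x→y) − dist(y)`. -/
def slack (T : SPTree S cost v) (d : S.D) : Fin n → ℝ :=
  T.dist (S.tail d) + cost d - T.dist (S.head d)

/-- A vertex `x` is red if the tree path from the root `v` to `x` uses the dart `v→u`;
here `u` is the head of that dart. -/
def Red (T : SPTree S cost v) (u x : S.V) : Prop := RedOf S T.pred v u x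

/-- A dart is active if its tail is blue and its head is red. -/
def Active (T : SPTree S cost v) (u : S.V) (d : S.D) : Prop :=
  ¬ T.Red u (S.tail d) ∧ T.Red u (S.head d)

/-- The darts of the shortest path tree (both orientations of each tree edge). -/
def treeDarts (T : SPTree S cost v) : Set S.D := predDarts S T.pred v

end SPTree

/-- `K` realizes the fundamental cycle of the dart `d` with the tree whose darts are
`TD`: the concatenation `d :: K` is a simple closed walk whose non-`d` darts all lie in
the tree. -/
def IsFundCycleWalk (S : CombSurface) (TD : Set S.D) (d : S.D) (K : List S.D) : Prop :=
  IsWalk S (S.head d) (S.tail d) K ∧ (∀ e ∈ K, e ∈ TD) ∧ ((d :: K).map S.head).Nodup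

/-- The homology signature of the fundamental cycle `d :: K`. -/
def cycleSig (S : CombSurface) (H : HomologyBasis S) (d : S.D) (K : List S.D) :
    Fin (2 * S.g) → ℝ :=
  fun i => (H.cyc i d : ℝ) + (K.map fun e => (H.cyc i e : ℝ)).sum

/-- `Y` is a subgraph of the cut graph `X` in which every incident dual vertex other than
`q` and `r` has degree at least 2. -/
def IsCore (S : CombSurface) (X : Set S.D) (q r : S.F) (Y : Set S.D) : Prop :=
  Y ⊆ X ∧ (∀ d ∈ Y, S.rev d ∈ Y) ∧
    ∀ d ∈ Y, S.left d ≠ q → S.left d ≠ r → ∃ d' ∈ Y, d' ≠ d ∧ S.left d' = S.left d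

/-- The 2-core of the cut graph `X` (keeping `q` and `r`): the largest subgraph in which
every dual vertex other than `q` and `r` has degree at least 2; equivalently, the result
of repeatedly deleting degree-1 dual vertices other than `q` and `r`. -/
def twoCore (S : CombSurface) (X : Set S.D) (q r : S.F) : Set S.D :=
  ⋃₀ {Y | IsCore S X q r Y}

/-- An oriented cut path of the 2-core `X2`: a directed dual path whose darts lie in `X2`
and whose internal dual vertices are not `q` or `r` and have degree exactly 2 in `X2`. -/
def IsCutPath (S : CombSurface) (X2 : Set S.D) (q r : S.F) (P : List S.D) : Prop :=
  (∀ d ∈ P, d ∈ X2) ∧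
    P.Chain' fun d₁ d₂ => S.right d₁ = S.left d₂ ∧ S.right d₁ ≠ q ∧ S.right d₁ ≠ r ∧
      ∀ e ∈ X2, S.left e = S.right d₁ → e = S.rev d₁ ∨ e = d₂

/-- `L` is the clockwise facial walk around the face `p` (cyclically closed). -/
def IsFacialCycle (S : CombSurface) (p : S.F) (L : List S.D) : Prop :=
  L ≠ [] ∧ (∀ d ∈ L, S.left d = p) ∧
    List.Chain' (fun d₁ d₂ => d₂ = S.rev (S.next d₁)) (L ++ L.take 1)

/-- Elementary combinatorial homotopy moves in the surface punctured at the faces `o` and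
`r`, where the first endpoint of a walk may additionally slide forward or backward along
the fixed walk `R` (the walk `u₁→u₂→⋯→u_{k-1}`): removal/insertion of a spur, exchanging
two arcs that together bound a face other than `o` and `r`, and sliding the initial
endpoint along `R`. -/
inductive RHStep (S : CombSurface) (o r : S.F) (R : List S.D) :
    List S.D → List S.D → Prop where
  | spur (P Q : List S.D) (d : S.D) :
      RHStep S o r R (P ++ d :: S.rev d :: Q) (P ++ Q)
  | face (P Q A B : List S.D) (p : S.F) (hpo : p ≠ o) (hpr : p ≠ r)
      (hface : IsFacialCycle S p (A ++ (B.reverse.map S.rev))) :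
      RHStep S o r R (P ++ A ++ Q) (P ++ B ++ Q)
  | slide (P : List S.D) (d : S.D) (hd : d ∈ R) :
      RHStep S o r R (d :: P) P

/-- Restricted homotopy of walks with respect to a dart whose left face is `o`: homotopy
in the surface punctured at `o` and `r`, where the first endpoint may move forward or
backward along the walk `R`. -/
def RHomotopic (S : CombSurface) (o r : S.F) (R : List S.D) (P₁ P₂ : List S.D) : Prop :=
  Relation.EqvGen (RHStep S o r R) P₁ P₂

theorem sum_fiber_mul {D V : Type*} [Fintype D] [Fintype V] [DecidableEq V] (hd : D → V)
    (φ : D → ℝ) (β : V → ℝ) :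
    ∑ d, φ d * β (hd d) = ∑ v, (∑ d ∈ univ.filter (fun d => hd d = v), φ d) * β v := by
  rw [← Finset.sum_fiberwise univ hd]
  refine Finset.sum_congr rfl fun v _ => ?_
  rw [Finset.sum_mul]
  refine Finset.sum_congr rfl fun d hd' => ?_
  rw [(Finset.mem_filter.1 hd').2]

theorem sum_antisymm_mul {D V : Type*} [Fintype D] {rev : D → D}
    (hrev : Function.Involutive rev) (hd : D → V) {φ : D → ℝ} (hφ : ∀ d, φ (rev d) = -φ d)
    (β : V → ℝ) :
    ∑ d, φ d * (β (hd d) - β (hd (rev d))) = 2 * ∑ d, φ d * β (hd d) := by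
  have h : ∑ d, φ d * β (hd (rev d)) = -∑ d, φ d * β (hd d) := by
    rw [← Equiv.sum_comp hrev.toPerm, ← Finset.sum_neg_distrib]
    refine Finset.sum_congr rfl fun d _ => ?_
    simp [hφ, hrev d]
  simp only [mul_sub, Finset.sum_sub_distrib, h]
  ring

/-- On a connected graph with one edge fewer than vertices, every antisymmetric function on the
darts is the coboundary of a potential. -/
theorem exists_potential_of_tree {D V : Type*} [Fintype D] [Fintype V] [Nonempty V]
    {rev : D → D} (hrev : Function.Involutive rev) (hne : ∀ d, rev d ≠ d) (hd : D → V)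
    (A : Finset D) (hA : ∀ d ∈ A, rev d ∈ A)
    (hconn : ∀ v w : V,
      Relation.ReflTransGen (fun a b => ∃ d ∈ A, hd (rev d) = a ∧ hd d = b) v w)
    (hcard : A.card = 2 * (Fintype.card V - 1)) {φ : D → ℝ} (hφ : ∀ d, φ (rev d) = -φ d) :
    ∃ β : V → ℝ, ∀ d ∈ A, φ d = β (hd d) - β (hd (rev d)) := by
  let e := Fintype.equivFin D
  let B : Finset D := A.filter fun d => e d < e (rev d)
  have hAB : ∀ d ∈ A, d ∈ B ∨ rev d ∈ B := by
    intro d h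
    rcases lt_or_gt_of_ne (e.injective.ne (hne d)) with h' | h'
    · exact Or.inr (by simp [B, hA d h, hrev d, h'])
    · exact Or.inl (by simp [B, h, h'])
  have hBcard : A.card ≤ 2 * B.card := by
    have : A ⊆ B ∪ B.image rev := by
      intro d h
      rcases hAB d h with h' | h'
      · exact Finset.mem_union_left _ h'
      · exact Finset.mem_union_right _ (Finset.mem_image.2 ⟨_, h', hrev d⟩)
    have := (Finset.card_le_card this).trans (Finset.card_union_le _ _)
    have := Finset.card_image_le (s := B) (f := rev)
    omega
  have hBcard' : 2 * B.card ≤ A.card := by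
    have hdisj : Disjoint B (B.image rev) := by
      rw [Finset.disjoint_left]
      intro d h h'
      obtain ⟨x, hx, rfl⟩ := Finset.mem_image.1 h'
      simp only [B, Finset.mem_filter, hrev x] at h hx
      exact lt_asymm h.2 hx.2
    have hsub : B ∪ B.image rev ⊆ A := by
      intro d h
      rcases Finset.mem_union.1 h with h' | h'
      · exact (Finset.mem_filter.1 h').1
      · obtain ⟨x, hx, rfl⟩ := Finset.mem_image.1 h'
        exact hA _ (Finset.mem_filter.1 hx).1
    have := Finset.card_le_card hsub
    rw [Finset.card_union_of_disjoint hdisj,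
      Finset.card_image_of_injective _ hrev.injective] at this
    omega
  let δ : (V → ℝ) →ₗ[ℝ] (B → ℝ) :=
    { toFun := fun β d => β (hd d) - β (hd (rev d))
      map_add' := by intros; ext; simp; ring
      map_smul' := by intros; ext; simp; ring }
  have hker : LinearMap.ker δ ≤ Submodule.span ℝ {fun _ => (1 : ℝ)} := by
    intro β hβ
    have hB : ∀ d ∈ B, β (hd d) = β (hd (rev d)) := fun d h =>
      sub_eq_zero.1 (congrFun (LinearMap.mem_ker.1 hβ) ⟨d, h⟩)
    have hedge : ∀ d ∈ A, β (hd (rev d)) = β (hd d) := by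
      intro d h
      rcases hAB d h with h' | h'
      · exact (hB d h').symm
      · simpa [hrev d] using hB _ h'
    have hconst : ∀ v w, β v = β w := by
      intro v w
      induction hconn v w with
      | refl => rfl
      | tail _ h ih =>
        obtain ⟨d, hd', rfl, rfl⟩ := h
        exact ih.trans (hedge d hd')
    obtain ⟨v₀⟩ := ‹Nonempty V›
    refine Submodule.mem_span_singleton.2 ⟨β v₀, ?_⟩
    ext w
    simp [hconst v₀ w]
  have hker1 : Module.finrank ℝ (LinearMap.ker δ) ≤ 1 :=
    (Submodule.finrank_mono hker).trans ((finrank_span_le_card _).trans (by simp))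
  have hrank := LinearMap.finrank_range_add_finrank_ker δ
  have htop : LinearMap.range δ = ⊤ := by
    apply Submodule.eq_top_of_finrank_eq
    have := Submodule.finrank_le (LinearMap.range δ)
    simp only [Module.finrank_fintype_fun_eq_card, Fintype.card_coe] at this hrank ⊢
    omega
  obtain ⟨β, hβ⟩ := LinearMap.range_eq_top.1 htop fun d => φ d
  have hB : ∀ d ∈ B, φ d = β (hd d) - β (hd (rev d)) := fun d h =>
    (congrFun hβ ⟨d, h⟩).symm
  refine ⟨β, fun d h => ?_⟩
  rcases hAB d h with h' | h'
  · exact hB d h'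
  · have := hB _ h'
    rw [hφ, hrev d] at this
    linarith

namespace CombSurface

variable (S : CombSurface)

/-- The boundary of a function on the faces is a circulation. -/
theorem sum_boundary_mul_head (a : S.F → ℝ) (β : S.V → ℝ) :
    ∑ d, (a (S.right d) - a (S.left d)) * β (S.head d) = 0 := by
  simp only [sub_mul, Finset.sum_sub_distrib]
  rw [sub_eq_zero, ← (Equiv.ofBijective S.next S.next_bij).sum_comp]
  refine Finset.sum_congr rfl fun d _ => ?_
  simp [right, S.left_step, S.head_next]

theorem right_rev (d : S.D) : S.right (S.rev d) = S.left d := by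
  simp [right, S.rev_invol]

/-- An antisymmetric circulation with trivial homology signature is a boundary. -/
theorem exists_boundary_of_sig_eq_zero (H : HomologyBasis S) [Nonempty S.V] [Nonempty S.F]
    {φ : S.D → ℝ} (hφ : ∀ d, φ (S.rev d) = -φ d)
    (hcirc : ∀ β : S.V → ℝ, ∑ d, φ d * β (S.head d) = 0)
    (hsig : ∀ i, ∑ d, φ d * (H.cyc i d : ℝ) = 0) :
    ∃ α : S.F → ℝ, ∀ d, φ d = α (S.right d) - α (S.left d) := by
  obtain ⟨hCrev, hCconn, hCcard⟩ := H.cotree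
  obtain ⟨hTrev, hTconn, hTcard⟩ := H.tree
  obtain ⟨α, hα⟩ := exists_potential_of_tree S.rev_invol S.rev_ne S.right H.C hCrev
    (by simp only [right_rev]; exact hCconn) hCcard hφ
  simp only [right_rev] at hα
  refine ⟨α, ?_⟩
  let ω : S.D → ℝ := fun d => φ d - (α (S.right d) - α (S.left d))
  have hω : ∀ d, ω (S.rev d) = -ω d := by
    intro d
    simp only [ω, hφ, right, S.rev_invol]
    ring
  have hωcirc : ∀ β : S.V → ℝ, ∑ d, ω d * β (S.head d) = 0 := by
    intro β
    simp only [ω, sub_mul (φ _), Finset.sum_sub_distrib, hcirc,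
      sum_boundary_mul_head, sub_zero]
  have hωC : ∀ d ∈ H.C, ω d = 0 := fun d h => sub_eq_zero.2 (hα d h)
  have hωsig : ∀ i, ∑ d, ω d * (H.cyc i d : ℝ) = 0 := by
    intro i
    have h0 : ∑ d, (H.cyc i d : ℝ) * α (S.right d) = 0 := by
      rw [sum_fiber_mul]
      refine Finset.sum_eq_zero fun p _ => ?_
      have := congrArg (Int.cast : ℤ → ℝ) (H.cyc_circ i p)
      push_cast at this
      rw [this, zero_mul]
    have h1 := sum_antisymm_mul S.rev_invol S.right
      (φ := fun d => (H.cyc i d : ℝ)) (by simp [H.cyc_antisym]) α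
    simp only [right_rev, h0, mul_zero] at h1
    simp only [ω, sub_mul (φ _), Finset.sum_sub_distrib, hsig, zero_sub, neg_eq_zero]
    simpa only [mul_comm] using h1
  have hωL : ∀ i, ω (H.ell i) = 0 := by
    intro i
    have hsum := hωsig i
    rw [Finset.sum_eq_add (H.ell i) (S.rev (H.ell i)) (S.rev_ne _).symm] at hsum
    · simp only [hω, H.cyc_antisym, H.cyc_ell] at hsum
      push_cast at hsum
      linarith
    · intro d _ hd
      by_cases hc : H.cyc i d = 0
      · simp [hc]
      · rcases H.cyc_supp i d hc with h | h | h
        · simp [hωC d h]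
        · exact absurd h hd.1
        · exact absurd h hd.2
    · simp
    · simp
  obtain ⟨β, hβ⟩ := exists_potential_of_tree S.rev_invol S.rev_ne S.head H.T hTrev
    hTconn hTcard hω
  have hωT : ∀ d, d ∉ H.T → ω d = 0 := by
    intro d hd
    have hmem : d ∈ H.T ∪ H.L ∪ H.C := by rw [H.cover]; exact Finset.mem_univ d
    simp only [Finset.mem_union] at hmem
    rcases hmem with (h | h) | h
    · exact absurd h hd
    · obtain ⟨i, rfl | rfl⟩ := H.ell_cover d h
      · exact hωL i
      · rw [hω, hωL, neg_zero]
    · exact hωC d h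
  have hsq : ∑ d, ω d * ω d = 0 := by
    rw [← mul_zero 2, ← hωcirc β, ← sum_antisymm_mul S.rev_invol S.head hω β]
    refine Finset.sum_congr rfl fun d _ => ?_
    by_cases hd : d ∈ H.T
    · rw [← hβ d hd]
    · simp [hωT d hd]
  intro d
  have := (Finset.sum_eq_zero_iff_of_nonneg fun d _ => mul_self_nonneg (ω d)).1 hsq d
    (Finset.mem_univ d)
  exact sub_eq_zero.1 (mul_self_eq_zero.1 this)

variable {S}

/-- A function on the faces that is non-negative and vanishes at the sink is zero once its boundary
is orthogonal to the drainage. -/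
theorem eq_zero_of_drainage {z : S.D → ℝ} {r : S.F} (hz : S.IsDrainage z r) {a : S.F → ℝ}
    (ha : ∀ p, 0 ≤ a p) (har : a r = 0)
    (h : ∑ d, (a (S.right d) - a (S.left d)) * z d = 0) (p : S.F) : a p = 0 := by
  have h1 := sum_antisymm_mul S.rev_invol S.right hz.1 a
  simp only [right_rev] at h1
  rw [sum_fiber_mul] at h1
  have h2 : ∑ q, -(S.dualImbalance z q * a q) = 0 := by
    rw [Finset.sum_neg_distrib, neg_eq_zero]
    have : ∑ d, z d * (a (S.right d) - a (S.left d)) = 0 := by simpa only [mul_comm] using h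
    unfold dualImbalance
    linarith
  have hnonneg : ∀ q ∈ univ, 0 ≤ -(S.dualImbalance z q * a q) := by
    intro q _
    by_cases hq : q = r
    · simp [hq, har]
    · nlinarith [hz.2 q hq, ha q]
  have h3 := (Finset.sum_eq_zero_iff_of_nonneg hnonneg).1 h2 p (Finset.mem_univ p)
  by_cases hp : p = r
  · rw [hp, har]
  · simpa [(hz.2 p hp).ne] using h3

/-- A boundary is zero if the drainage agrees with a difference of vertex potentials on its
support. -/
theorem boundary_eq_zero_of_drainage {z : S.D → ℝ} {r : S.F} (hz : S.IsDrainage z r)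
    (α : S.F → ℝ) (ζ : S.V → ℝ)
    (hζ : ∀ d, α (S.right d) ≠ α (S.left d) → z d = ζ (S.head d) - ζ (S.tail d)) (d : S.D) :
    α (S.right d) = α (S.left d) := by
  have key : ∀ f : ℝ → ℝ, (∀ x, 0 ≤ f x) → f (α r) = 0 → ∀ p, f (α p) = 0 := by
    intro f hf hfr
    refine eq_zero_of_drainage hz (a := fun p => f (α p)) (fun p => hf _) hfr ?_
    have hanti : ∀ d, f (α (S.right (S.rev d))) - f (α (S.left (S.rev d))) =
        -(f (α (S.right d)) - f (α (S.left d))) := by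
      intro d
      rw [right_rev, neg_sub]
      rfl
    rw [← mul_zero 2, ← S.sum_boundary_mul_head (fun p => f (α p)) ζ,
      ← sum_antisymm_mul S.rev_invol S.head hanti]
    refine Finset.sum_congr rfl fun d _ => ?_
    by_cases hd : α (S.right d) = α (S.left d)
    · simp [hd]
    · rw [hζ d hd, tail]
  have hconst : ∀ p, α p = α r := by
    intro p
    have h1 := key (fun x => max (x - α r) 0) (fun x => le_max_right _ _) (by simp) p
    have h2 := key (fun x => max (α r - x) 0) (fun x => le_max_right _ _) (by simp) p
    simp only [max_eq_right_iff, sub_nonpos] at h1 h2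
    exact le_antisymm h1 h2
  rw [hconst, hconst (S.left d)]

end CombSurface

section Walks

variable {S : CombSurface} {n : ℕ} {cp : S.D → Fin n → ℝ}

theorem lexLe_iff_toLex {a b : Fin n → ℝ} : lexLe a b ↔ toLex a ≤ toLex b := by
  rw [le_iff_lt_or_eq]
  rfl

theorem isWalk_append {s t : S.V} {P Q : List S.D} :
    IsWalk S s t (P ++ Q) ↔ ∃ v, IsWalk S s v P ∧ IsWalk S v t Q := by
  induction P generalizing s with
  | nil => simp [IsWalk]
  | cons d P ih => simp [IsWalk, ih, and_assoc]

theorem pathCost_append (P Q : List S.D) :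
    pathCost S cp (P ++ Q) = pathCost S cp P + pathCost S cp Q := by
  simp [pathCost]

theorem pathCost_apply (P : List S.D) (i : Fin n) :
    pathCost S cp P i = (P.map fun d => cp d i).sum := by
  induction P with
  | nil => rfl
  | cons d P ih => simpa [pathCost] using ih

theorem IsShortestWalk.of_append_left {s t v : S.V} {P Q : List S.D}
    (h : IsShortestWalk S cp s t (P ++ Q)) (hP : IsWalk S s v P) (hQ : IsWalk S v t Q) :
    IsShortestWalk S cp s v P := by
  refine ⟨hP, fun R hR => ?_⟩
  have := h.2 (R ++ Q) (isWalk_append.2 ⟨v, hR, hQ⟩)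
  rw [lexLe_iff_toLex, pathCost_append, pathCost_append, toLex_add, toLex_add] at this
  exact lexLe_iff_toLex.2 (le_of_add_le_add_right this)

theorem IsShortestWalk.pathCost_eq {s t : S.V} {P Q : List S.D}
    (hP : IsShortestWalk S cp s t P) (hQ : IsShortestWalk S cp s t Q) :
    pathCost S cp P = pathCost S cp Q :=
  toLex_inj.1 (le_antisymm (lexLe_iff_toLex.1 (hP.2 Q hQ.1)) (lexLe_iff_toLex.1 (hQ.2 P hP.1)))

/-- All darts of shortest walks from `s` are tense with respect to a common potential. -/
theorem exists_tense_potential (S : CombSurface) (cp : S.D → Fin n → ℝ) (s : S.V) :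
    ∃ dist : S.V → Fin n → ℝ, ∀ t P, IsShortestWalk S cp s t P → ∀ d ∈ P,
      cp d = dist (S.head d) - dist (S.tail d) := by
  let dist : S.V → Fin n → ℝ := fun v =>
    if h : ∃ P, IsShortestWalk S cp s v P then pathCost S cp h.choose else 0
  have hdist : ∀ v P, IsShortestWalk S cp s v P → dist v = pathCost S cp P := by
    intro v P hP
    have h : ∃ P, IsShortestWalk S cp s v P := ⟨P, hP⟩
    simp only [dist, dif_pos h]
    exact h.choose_spec.pathCost_eq hP
  refine ⟨dist, fun t P hP d hd => ?_⟩
  obtain ⟨A, B, rfl⟩ := List.append_of_mem hd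
  obtain ⟨v, hA, hv, hB⟩ := isWalk_append.1 hP.1
  subst hv
  have h1 := hP.of_append_left hA ⟨rfl, hB⟩
  have h2 : IsShortestWalk S cp s (S.head d) (A ++ [d]) :=
    IsShortestWalk.of_append_left (Q := B) (by simpa using hP)
      (isWalk_append.2 ⟨_, hA, rfl, rfl⟩) hB
  rw [hdist _ _ h1, hdist _ _ h2, pathCost_append]
  simp [pathCost]

theorem IsWalk.sum_sub {s t : S.V} {P : List S.D} (h : IsWalk S s t P) (β : S.V → ℝ) :
    (P.map fun d => β (S.head d) - β (S.tail d)).sum = β t - β s := by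
  induction P generalizing s with
  | nil => cases h; simp
  | cons d P ih =>
    obtain ⟨rfl, h⟩ := h
    simp [ih h]

theorem sum_listFlow_mul (P : List S.D) (f : S.D → ℝ) :
    ∑ d, listFlow S P d * f d = (P.map f).sum := by
  induction P with
  | nil => simp [listFlow]
  | cons e P ih =>
    rw [List.map_cons, List.sum_cons, ← ih]
    simp [listFlow, List.count_cons, add_mul, Finset.sum_add_distrib, add_comm]

theorem IsWalk.pairwise_lt {ell : S.V → ℝ} {s t : S.V} {P : List S.D} (h : IsWalk S s t P)
    (hP : ∀ d ∈ P, ell (S.tail d) < ell (S.head d)) :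
    (∀ d ∈ P, ell s < ell (S.head d)) ∧
      P.Pairwise fun d e => ell (S.head d) < ell (S.head e) := by
  induction P generalizing s with
  | nil => simp
  | cons d P ih =>
    obtain ⟨rfl, h⟩ := h
    have hd := hP d (by simp)
    obtain ⟨h1, h2⟩ := ih h fun e he => hP e (by simp [he])
    refine ⟨fun e he => ?_, List.pairwise_cons.2 ⟨h1, h2⟩⟩
    rcases List.mem_cons.1 he with rfl | he
    · exact hd
    · exact hd.trans (h1 e he)

end Walks

section DartCost

variable (S : CombSurface) (H : HomologyBasis S) (z c : S.D → ℝ) (d : S.D)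

theorem dartCostFull_length : dartCostFull S H z c d (Fin.succ 0) = 1 := rfl

theorem dartCostFull_sig (i : Fin (2 * S.g)) :
    dartCostFull S H z c d i.castSucc.succ.succ = (H.cyc i d : ℝ) := by
  simp [dartCostFull]

theorem dartCostFull_drainage :
    dartCostFull S H z c d (Fin.last (2 * S.g)).succ.succ = z d := by
  simp only [dartCostFull, Fin.cons_succ, Fin.snoc_last]

end DartCost

/-- Corollary 2 of the paper.  Let `c : darts → ℝ` be a dart cost
function admitting no negative-cost directed cycles, let `c'` be its lexicographic
perturbation, and let `s, t ∈ V`.  Then the shortest directed path from `s` to `t` with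
respect to `c'` (i.e., the directed `s,t`-path of lexicographically minimum total
perturbed cost) is unique, and it is also a shortest `s,t`-path with respect to the
unperturbed costs `c`. -/
theorem holiest_unique_path (S : CombSurface) (H : HomologyBasis S) (z : S.D → ℝ)
    (r : S.F) (hz : S.IsDrainage z r) (c : S.D → ℝ)
    (hnoneg : ∀ (w : S.V) (P : List S.D), P ≠ [] → IsWalk S w w P → 0 ≤ (P.map c).sum)
    (s t : S.V) (P₁ P₂ : List S.D)
    (h₁ : IsShortestWalk S (dartCostFull S H z c) s t P₁)
    (h₂ : IsShortestWalk S (dartCostFull S H z c) s t P₂) :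
    P₁ = P₂ ∧ ∀ Q, IsWalk S s t Q → (P₁.map c).sum ≤ (Q.map c).sum := by
  set cp := dartCostFull S H z c with hcp
  have hcost := h₁.pathCost_eq h₂
  constructor
  swap
  · intro Q hQ
    have hle : ∀ a b : Fin (2 * S.g + 3) → ℝ, lexLe a b → a 0 ≤ b 0 := by
      rintro a b (⟨i, hi, hlt⟩ | rfl)
      · rcases (Fin.zero_le i).eq_or_lt with rfl | h0
        · exact hlt.le
        · exact (hi 0 h0).le
      · exact le_rfl
    have := hle _ _ (h₁.2 Q hQ)
    rwa [pathCost_apply, pathCost_apply] at this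
  have hcost_sum : ∀ i, (P₁.map fun d => cp d i).sum = (P₂.map fun d => cp d i).sum := by
    intro i
    rw [← pathCost_apply, ← pathCost_apply, hcost]
  obtain ⟨dist, hdist⟩ := exists_tense_potential S cp s
  have htense : ∀ d, d ∈ P₁ ∨ d ∈ P₂ → ∀ i,
      cp d i = dist (S.head d) i - dist (S.tail d) i := by
    rintro d (hd | hd) i
    · exact congrFun (hdist t P₁ h₁ d hd) i
    · exact congrFun (hdist t P₂ h₂ d hd) i
  have htail_rev : ∀ d, S.tail (S.rev d) = S.head d := by
    intro d
    simp [CombSurface.tail, S.rev_invol]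
  have hlen : ∀ d, d ∈ P₁ ∨ d ∈ P₂ →
      dist (S.head d) (Fin.succ 0) - dist (S.tail d) (Fin.succ 0) = 1 := by
    intro d hd
    rw [← htense d hd, hcp, dartCostFull_length]
  have hrev : ∀ d, d ∈ P₁ ∨ d ∈ P₂ → ¬(S.rev d ∈ P₁ ∨ S.rev d ∈ P₂) := by
    intro d hd hd'
    have h1 := hlen d hd
    have h2 := hlen _ hd'
    rw [htail_rev] at h2
    change dist (S.tail d) (Fin.succ 0) - _ = 1 at h2
    linarith
  let f : S.D → ℝ := fun d => listFlow S P₁ d - listFlow S P₂ d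
  let φ : S.D → ℝ := fun d => f d - f (S.rev d)
  have hφ : ∀ d, φ (S.rev d) = -φ d := by
    intro d
    simp [φ, S.rev_invol]
  have hsum : ∀ k : S.D → ℝ, ∑ d, f d * k d = (P₁.map k).sum - (P₂.map k).sum := by
    intro k
    simp [f, sub_mul, Finset.sum_sub_distrib, sum_listFlow_mul]
  have hφsum : ∀ k : S.D → ℝ, ∑ d, φ d * k d = ∑ d, f d * (k d - k (S.rev d)) := by
    intro k
    simp only [φ, sub_mul (f _), mul_sub, Finset.sum_sub_distrib, sub_right_inj]
    have hinv : Function.Involutive S.rev := S.rev_invol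
    rw [← Equiv.sum_comp hinv.toPerm]
    simp [hinv _]
  have : Nonempty S.V := ⟨s⟩
  have : Nonempty S.F := ⟨r⟩
  obtain ⟨α, hα⟩ := S.exists_boundary_of_sig_eq_zero H hφ
    (by
      intro β
      rw [hφsum]
      change ∑ d, f d * (β (S.head d) - β (S.tail d)) = 0
      rw [hsum, h₁.1.sum_sub, h₂.1.sum_sub, sub_self])
    (by
      intro i
      have := hcost_sum i.castSucc.succ.succ
      simp only [hcp, dartCostFull_sig] at this
      simp only [hφsum, H.cyc_antisym, Int.cast_neg, sub_neg_eq_add, mul_add,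
        Finset.sum_add_distrib, hsum, this, sub_self, add_zero])
  have hfzero : ∀ d, ¬(d ∈ P₁ ∨ d ∈ P₂) → f d = 0 := by
    intro d hd
    rw [not_or] at hd
    simp [f, listFlow, List.count_eq_zero_of_not_mem hd.1, List.count_eq_zero_of_not_mem hd.2]
  have hzpot : ∀ d, d ∈ P₁ ∨ d ∈ P₂ → z d =
      dist (S.head d) (Fin.last (2 * S.g)).succ.succ -
        dist (S.tail d) (Fin.last (2 * S.g)).succ.succ := by
    intro d hd
    rw [← htense d hd, hcp, dartCostFull_drainage]
  have hφzero : ∀ d, φ d = 0 := by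
    intro d
    rw [hα, sub_eq_zero]
    refine CombSurface.boundary_eq_zero_of_drainage hz α
      (fun v => dist v (Fin.last (2 * S.g)).succ.succ) (fun d hd => ?_) d
    by_cases hd1 : d ∈ P₁ ∨ d ∈ P₂
    · exact hzpot d hd1
    by_cases hd2 : S.rev d ∈ P₁ ∨ S.rev d ∈ P₂
    · have := hzpot _ hd2
      rw [hz.1, htail_rev] at this
      change -z d = dist (S.tail d) _ - _ at this
      linarith
    · have : φ d = 0 := by simp [φ, hfzero d hd1, hfzero _ hd2]
      exact absurd (sub_eq_zero.1 ((hα d).symm.trans this)) hd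
  have hperm : P₁.Perm P₂ := by
    rw [List.perm_iff_count]
    intro d
    have hfd : f d = 0 := by
      by_cases hd : d ∈ P₁ ∨ d ∈ P₂
      · have := hφzero d
        simpa [φ, hfzero _ (hrev d hd)] using this
      · exact hfzero d hd
    have := sub_eq_zero.1 hfd
    simp only [listFlow] at this
    convert Nat.cast_injective this
  have hlt : ∀ d, d ∈ P₁ ∨ d ∈ P₂ →
      dist (S.tail d) (Fin.succ 0) < dist (S.head d) (Fin.succ 0) := fun d hd => by
    linarith [hlen d hd]
  refine hperm.eq_of_pairwise (fun a b _ _ hab hba => absurd hab (lt_asymm hba))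
    (h₁.1.pairwise_lt (ell := fun v => dist v (Fin.succ 0)) fun d hd => hlt d (Or.inl hd)).2
    (h₂.1.pairwise_lt (ell := fun v => dist v (Fin.succ 0)) fun d hd => hlt d (Or.inr hd)).2
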